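/- There exists a smooth function R : (0,2) × (0,π/2) → ℝ_{>0} such that: (R1) R(ρ,ψ) = ρ²(cos²ψ + α² sin²ψ) whenever (ρ,ψ) = (1,π/4) or (ρ,ψ) ∉ [1/2,3/2] × [π/8,3π/8]; (R2) ∂R/∂ρ(ρ,ψ) > 0 for all (ρ,ψ) ≠ (1,π/4); (R3) the total derivative DR vanishes at (1,π/4). -/

import Mathlib

open Real Set

lemma st_mono : Monotone Real.smoothTransition := Real.smoothTransition.monotone

lemma st_deriv_nonneg (x : ℝ) : 0 ≤ deriv Real.smoothTransition x := st_mono.deriv_nonneg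

lemma st_smooth : ContDiff ℝ (⊤ : ℕ∞) Real.smoothTransition := Real.smoothTransition.contDiff

lemma st_hasDeriv (x : ℝ) : HasDerivAt Real.smoothTransition (deriv Real.smoothTransition x) x :=
  ((st_smooth.differentiable (by simp)) x).hasDerivAt

/-- bump in t -/
noncomputable def ee (t : ℝ) : ℝ := Real.smoothTransition (1 - 4 * t ^ 2)
noncomputable def bb (t : ℝ) : ℝ := Real.smoothTransition (2 - 8 * t ^ 2)
noncomputable def xx (s : ℝ) : ℝ := Real.smoothTransition (1 - 8 * s ^ 2)
noncomputable def th (ε s : ℝ) : ℝ := ε * sin (s / ε) * xx s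

lemma ee_smooth : ContDiff ℝ (⊤ : ℕ∞) ee := st_smooth.comp (by fun_prop)
lemma bb_smooth : ContDiff ℝ (⊤ : ℕ∞) bb := st_smooth.comp (by fun_prop)
lemma xx_smooth : ContDiff ℝ (⊤ : ℕ∞) xx := st_smooth.comp (by fun_prop)
lemma th_smooth (ε : ℝ) : ContDiff ℝ (⊤ : ℕ∞) (th ε) := by
  have := xx_smooth
  unfold th
  fun_prop

lemma ee_deriv (t : ℝ) : ∃ d, HasDerivAt ee d t ∧ t * d ≤ 0 := by
  have h1 : HasDerivAt (fun t : ℝ => 1 - 4 * t ^ 2) (-(8 * t)) t := by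
    have := ((hasDerivAt_pow 2 t).const_mul 4).const_sub 1
    exact this.congr_deriv (by norm_num; ring)
  refine ⟨_, (st_hasDeriv _).comp t h1, ?_⟩
  have := mul_nonneg (st_deriv_nonneg (1 - 4 * t ^ 2)) (sq_nonneg t)
  nlinarith

lemma bb_deriv_zero (t : ℝ) (h : t ^ 2 < 1 / 8) : deriv bb t = 0 := by
  have : bb =ᶠ[nhds t] fun _ => (1 : ℝ) := by
    have ho : ∀ᶠ x in nhds t, x ^ 2 < 1 / 8 :=
      (continuous_pow 2).continuousAt.eventually_lt continuousAt_const h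
    filter_upwards [ho] with x hx
    exact Real.smoothTransition.one_of_one_le (by linarith)
  rw [this.deriv_eq]; simp

lemma bb_bound : ∃ B : ℝ, 0 < B ∧ ∀ t ∈ Icc (-1 : ℝ) 1, |deriv bb t| ≤ B := by
  obtain ⟨C, hC⟩ := (isCompact_Icc (a := (-1 : ℝ)) (b := 1)).exists_bound_of_continuousOn
    (bb_smooth.continuous_deriv (by simp)).continuousOn
  refine ⟨|C| + 1, by positivity, fun t ht => ?_⟩
  have := hC t ht
  rw [Real.norm_eq_abs] at this
  linarith [le_abs_self C]

lemma xx_zero (s : ℝ) (h : 1 / 8 ≤ s ^ 2) : xx s = 0 :=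
  Real.smoothTransition.zero_of_nonpos (by linarith)

lemma th_abs (ε s : ℝ) (hε : 0 < ε) : |th ε s| ≤ ε := by
  unfold th
  rw [abs_mul, abs_mul, abs_of_pos hε, abs_of_nonneg (show 0 ≤ xx s from Real.smoothTransition.nonneg _)]
  have h1 := abs_sin_le_one (s / ε)
  have h2 : xx s ≤ 1 := Real.smoothTransition.le_one _
  have h3 : 0 ≤ xx s := Real.smoothTransition.nonneg _
  calc ε * |sin (s / ε)| * xx s ≤ ε * 1 * 1 := by gcongr
    _ = ε := by ring

lemma th_deriv (ε : ℝ) (hε : 0 < ε) : HasDerivAt (th ε) 1 0 := by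
  have hx := ((xx_smooth.differentiable (by simp)) 0).hasDerivAt
  have h0 : xx 0 = 1 := Real.smoothTransition.one_of_one_le (by norm_num)
  have h1 : HasDerivAt (fun s : ℝ => ε * sin (s / ε)) (ε * (cos (0 / ε) * (1 / ε))) 0 :=
    (((hasDerivAt_id (0 : ℝ)).div_const ε).sin).const_mul ε
  exact (h1.mul hx).congr_deriv (by simp [h0]; field_simp)

noncomputable def ff (κ ε ρ s : ℝ) : ℝ :=
  ρ - (ρ - 1) * ee (ρ - 1) * xx s + κ * th ε s * bb (ρ - 1)

lemma ff_pos (κ ε ρ s : ℝ) (hκ : |κ| ≤ 1) (hε : 0 < ε) (hε' : ε < 1 / 2) (hρ : 0 < ρ) :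
    0 < ff κ ε ρ s := by
  unfold ff
  have e0 : 0 ≤ ee (ρ - 1) := Real.smoothTransition.nonneg _
  have e1 : ee (ρ - 1) ≤ 1 := Real.smoothTransition.le_one _
  have x0 : 0 ≤ xx s := Real.smoothTransition.nonneg _
  have x1 : xx s ≤ 1 := Real.smoothTransition.le_one _
  have b0 : 0 ≤ bb (ρ - 1) := Real.smoothTransition.nonneg _
  have b1 : bb (ρ - 1) ≤ 1 := Real.smoothTransition.le_one _
  have ex0 := mul_nonneg e0 x0
  have ex1 : ee (ρ - 1) * xx s ≤ 1 := mul_le_one₀ e1 x0 x1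
  have hl : min ρ 1 ≤ ρ - (ρ - 1) * ee (ρ - 1) * xx s := by
    rcases le_total ρ 1 with h | h
    · rw [min_eq_left h]; nlinarith
    · rw [min_eq_right h]; nlinarith
  by_cases hb : ρ ≤ 1 / 2
  · have : bb (ρ - 1) = 0 := Real.smoothTransition.zero_of_nonpos (by nlinarith)
    rw [this]
    have : 0 < min ρ 1 := by positivity
    linarith
  · have h1 : |κ * th ε s * bb (ρ - 1)| ≤ ε := by
      rw [abs_mul, abs_mul, abs_of_nonneg b0]
      calc |κ| * |th ε s| * bb (ρ - 1) ≤ 1 * ε * 1 := by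
            gcongr
            exact th_abs ε s hε
        _ = ε := by ring
    have := (abs_le.1 h1).1
    have h2 : 1 / 2 ≤ min ρ 1 := le_min (by linarith) (by norm_num)
    linarith

lemma ff_deriv (κ ε ρ s B : ℝ) (hκ : |κ| ≤ 1) (hε : 0 < ε)
    (hB : ∀ t ∈ Icc (-1 : ℝ) 1, |deriv bb t| ≤ B)
    (hεB : ε * B < 1 - Real.smoothTransition (1 / 2)) (hρ : ρ ∈ Ioo (0 : ℝ) 2) 
    (hne : ¬ (ρ = 1 ∧ s = 0)) :
    ∃ d, HasDerivAt (fun ρ => ff κ ε ρ s) d ρ ∧ 0 < d := by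
  obtain ⟨d, hd, hd0⟩ := ee_deriv (ρ - 1)
  have hb := ((bb_smooth.differentiable (by simp)) (ρ - 1)).hasDerivAt
  have h1 : HasDerivAt (fun ρ : ℝ => ρ - 1) 1 ρ := (hasDerivAt_id ρ).sub_const 1
  have he' : HasDerivAt (fun ρ : ℝ => ee (ρ - 1)) d ρ := hd.comp_sub_const ρ 1
  have hb' : HasDerivAt (fun ρ : ℝ => bb (ρ - 1)) (deriv bb (ρ - 1)) ρ := hb.comp_sub_const ρ 1
  refine ⟨_, ((hasDerivAt_id ρ).sub ((h1.mul he').mul_const (xx s))).add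
    (hb'.const_mul (κ * th ε s)), ?_⟩
  have e0 : 0 ≤ ee (ρ - 1) := Real.smoothTransition.nonneg _
  have e1 : ee (ρ - 1) ≤ 1 := Real.smoothTransition.le_one _
  have x0 : 0 ≤ xx s := Real.smoothTransition.nonneg _
  have x1 : xx s ≤ 1 := Real.smoothTransition.le_one _
  have key : (1 * ee (ρ - 1) + (ρ - 1) * d) * xx s ≤ ee (ρ - 1) * xx s := by
    apply mul_le_mul_of_nonneg_right _ x0
    linarith
  have kx : ee (ρ - 1) * xx s ≤ ee (ρ - 1) := mul_le_of_le_one_right e0 x1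
  by_cases ht : (ρ - 1) ^ 2 < 1 / 8
  · rw [bb_deriv_zero _ ht]
    have : ee (ρ - 1) * xx s < 1 := by
      by_cases hρ1 : ρ = 1
      · have hs : s ≠ 0 := fun h => hne ⟨hρ1, h⟩
        have : xx s < 1 := Real.smoothTransition.lt_one_of_lt_one (by
          have : 0 < s ^ 2 := by positivity
          linarith)
        nlinarith
      · have : ee (ρ - 1) < 1 := Real.smoothTransition.lt_one_of_lt_one (by
          have : 0 < (ρ - 1) ^ 2 := by
            have := sub_ne_zero.2 hρ1
            positivity
          linarith)
        linarith
    linarith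
  · have h2 : ee (ρ - 1) ≤ Real.smoothTransition (1 / 2) := st_mono (by linarith)
    have h3 : |κ * th ε s * deriv bb (ρ - 1)| ≤ ε * B := by
      rw [abs_mul, abs_mul]
      calc |κ| * |th ε s| * |deriv bb (ρ - 1)| ≤ 1 * ε * B := by
            gcongr
            · exact th_abs ε s hε
            · exact hB _ ⟨by linarith [hρ.1], by linarith [hρ.2]⟩
        _ = ε * B := by ring
    have := (abs_le.1 h3).1
    linarith

theorem stmt_10 (α : ℝ) (hα : Irrational α) :
    ∃ R : ℝ × ℝ → ℝ, ContDiff ℝ (⊤ : ℕ∞) R ∧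
      (∀ p ∈ Ioo (0:ℝ) 2 ×ˢ Ioo 0 (π/2), 0 < R p) ∧
      (∀ p ∈ Ioo (0:ℝ) 2 ×ˢ Ioo 0 (π/2),
        (p = (1, π/4) ∨ p ∉ Icc (1/2 : ℝ) (3/2) ×ˢ Icc (π/8) (3*π/8)) →
        R p = p.1 ^ 2 * (cos p.2 ^ 2 + α ^ 2 * sin p.2 ^ 2)) ∧
      (∀ p ∈ Ioo (0:ℝ) 2 ×ˢ Ioo 0 (π/2), p ≠ (1, π/4) →
        0 < deriv (fun ρ => R (ρ, p.2)) p.1) ∧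
      fderiv ℝ R (1, π/4) = 0 := by
  obtain ⟨B, hB0, hB⟩ := bb_bound
  have hm : 0 < 1 - Real.smoothTransition (1 / 2) :=
    sub_pos.2 (Real.smoothTransition.lt_one_of_lt_one (by norm_num))
  obtain ⟨ε, hε, hε2, hεB⟩ : ∃ ε : ℝ, 0 < ε ∧ ε < 1 / 2 ∧
      ε * B < 1 - Real.smoothTransition (1 / 2) := by
    set m := 1 - Real.smoothTransition (1 / 2)
    refine ⟨min (1 / 4) (m / (2 * B)), by positivity, ?_, ?_⟩
    · exact (min_le_left _ _).trans_lt (by norm_num)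
    · calc min (1 / 4) (m / (2 * B)) * B ≤ m / (2 * B) * B := by
            gcongr; exact min_le_right _ _
        _ = m / 2 := by field_simp
        _ < m := by linarith
  set κ : ℝ := (1 - α ^ 2) / (1 + α ^ 2) with hκdef
  have hκ : |κ| ≤ 1 := by
    have : 0 < 1 + α ^ 2 := by positivity
    rw [hκdef, abs_div, abs_of_pos this, div_le_one this, abs_le]
    constructor <;> nlinarith [sq_nonneg α]
  have hα0 : α ≠ 0 := hα.ne_zero
  have hc : ∀ ψ : ℝ, 0 < cos ψ ^ 2 + α ^ 2 * sin ψ ^ 2 := by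
    intro ψ
    by_cases h : cos ψ = 0
    · have : sin ψ ^ 2 = 1 := by have := sin_sq_add_cos_sq ψ; rw [h] at this; linarith
      rw [h, this]; positivity
    · positivity
  have hsm : ContDiff ℝ (⊤ : ℕ∞) (fun p : ℝ × ℝ =>
      ff κ ε p.1 (p.2 - π / 4) ^ 2 * (cos p.2 ^ 2 + α ^ 2 * sin p.2 ^ 2)) := by
    have h1 := ee_smooth
    have h2 := bb_smooth
    have h3 := xx_smooth
    have h4 := th_smooth ε
    unfold ff
    fun_prop
  have ee0 : ee 0 = 1 := Real.smoothTransition.one_of_one_le (by norm_num)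
  have bb0 : bb 0 = 1 := Real.smoothTransition.one_of_one_le (by norm_num)
  have th0 : th ε 0 = 0 := by simp [th]
  refine ⟨_, hsm, ?_, ?_, ?_, ?_⟩
  · rintro ⟨ρ, ψ⟩ ⟨hρ, hψ⟩
    have := ff_pos κ ε ρ (ψ - π / 4) hκ hε hε2 hρ.1
    have := hc ψ
    dsimp only
    positivity
  · rintro ⟨ρ, ψ⟩ - h
    dsimp only
    congr 2
    rcases h with h | h
    · obtain ⟨rfl, rfl⟩ := Prod.mk.inj h
      simp [ff, th0]
    · by_cases hρ : ρ ∈ Icc (1 / 2 : ℝ) (3 / 2)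
      · have hψ : ψ ∉ Icc (π / 8) (3 * π / 8) := fun h' => h ⟨hρ, h'⟩
        have : xx (ψ - π / 4) = 0 := by
          apply xx_zero
          have := pi_gt_three
          rw [mem_Icc, not_and_or, not_le, not_le] at hψ
          rcases hψ with h | h
          · nlinarith
          · nlinarith
        simp [ff, th, this]
      · rw [mem_Icc, not_and_or, not_le, not_le] at hρ
        have h4 : 1 / 4 ≤ (ρ - 1) ^ 2 := by
          rcases hρ with h | h <;> nlinarith
        have h5 : ee (ρ - 1) = 0 := Real.smoothTransition.zero_of_nonpos (by linarith)
        have h6 : bb (ρ - 1) = 0 := Real.smoothTransition.zero_of_nonpos (by linarith)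
        simp [ff, h5, h6]
  · rintro ⟨ρ, ψ⟩ ⟨hρ, hψ⟩ hne
    dsimp only at *
    obtain ⟨d, hd, hd0⟩ := ff_deriv κ ε ρ (ψ - π / 4) B hκ hε hB hεB hρ (by
      rintro ⟨h1, h2⟩
      exact hne (by rw [h1, sub_eq_zero.1 h2]))
    have := ff_pos κ ε ρ (ψ - π / 4) hκ hε hε2 hρ.1
    have := hc ψ
    have hD : HasDerivAt (fun ρ => ff κ ε ρ (ψ - π / 4) ^ 2 * (cos ψ ^ 2 + α ^ 2 * sin ψ ^ 2)) _ ρ :=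
      (hd.pow 2).mul_const _
    rw [hD.deriv]
    simp only [Nat.cast_ofNat]
    positivity
  · have hF := ((hsm.differentiable (by simp)) (1, π / 4)).hasFDerivAt
    set L := fderiv ℝ (fun p : ℝ × ℝ =>
      ff κ ε p.1 (p.2 - π / 4) ^ 2 * (cos p.2 ^ 2 + α ^ 2 * sin p.2 ^ 2)) (1, π / 4)
    have hA : L (1, 0) = 0 := by
      have h1 : HasDerivAt (fun ρ : ℝ => (ρ, π / 4)) ((1 : ℝ), (0 : ℝ)) 1 :=
        (hasDerivAt_id (1 : ℝ)).prodMk (hasDerivAt_const _ _)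
      have h2 := hF.comp_hasDerivAt (1 : ℝ) h1
      have hf : HasDerivAt (fun ρ : ℝ => ff κ ε ρ (π / 4 - π / 4)) 0 1 := by
        obtain ⟨d, hd, -⟩ := ee_deriv (1 - 1)
        have h1 : HasDerivAt (fun ρ : ℝ => ρ - 1) 1 1 := (hasDerivAt_id (1 : ℝ)).sub_const 1
        have he' : HasDerivAt (fun ρ : ℝ => ee (ρ - 1)) d 1 := hd.comp_sub_const 1 1
        have hx0 : xx 0 = 1 := Real.smoothTransition.one_of_one_le (by norm_num)
        have := (hasDerivAt_id (1 : ℝ)).sub (h1.mul he')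
        have h7 : (fun ρ : ℝ => ff κ ε ρ (π / 4 - π / 4)) =
            fun ρ => ρ - (ρ - 1) * ee (ρ - 1) := by
          funext ρ; simp [ff, th0, hx0]
        rw [h7]
        exact this.congr_deriv (by simp [ee0])
      have h3 := (hf.pow 2).mul_const (cos (π / 4) ^ 2 + α ^ 2 * sin (π / 4) ^ 2)
      have := h2.unique h3
      simpa using this
    have hBB : L (0, 1) = 0 := by
      have h1 : HasDerivAt (fun ψ : ℝ => ((1 : ℝ), ψ)) ((0 : ℝ), (1 : ℝ)) (π / 4) :=
        (hasDerivAt_const _ _).prodMk (hasDerivAt_id _)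
      have h2 := hF.comp_hasDerivAt (π / 4) h1
      have hf : HasDerivAt (fun ψ : ℝ => ff κ ε 1 (ψ - π / 4)) κ (π / 4) := by
        have h7 : (fun ψ : ℝ => ff κ ε 1 (ψ - π / 4)) =
            fun ψ => 1 + κ * th ε (ψ - π / 4) := by
          funext ρ; simp [ff, bb0]
        have h9 : HasDerivAt (th ε) 1 (π / 4 - π / 4) := by
          rw [sub_self]; exact th_deriv ε hε
        rw [h7]
        have := ((h9.comp_sub_const (π / 4) (π / 4)).const_mul κ).const_add 1
        exact this.congr_deriv (by simp)
      have hcd := ((hasDerivAt_cos (π / 4)).pow 2).add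
        (((hasDerivAt_sin (π / 4)).pow 2).const_mul (α ^ 2))
      have h3 := (hf.pow 2).mul hcd
      have := h2.unique h3
      rw [this]
      have hf1 : ff κ ε 1 0 = 1 := by simp [ff, th0]
      have hs : (√2 : ℝ) ^ 2 = 2 := by norm_num
      have hp : (1 + α ^ 2) ≠ 0 := by positivity
      simp [hf1, cos_pi_div_four, sin_pi_div_four]
      rw [hκdef]
      field_simp
      rw [hs]
      ring
    ext
    · simpa using hA
    · simpa using hBB
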